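/- Let 𝓔 be a Polish space, let N ≥ 1, let f^N be a symmetric (exchangeable) Borel probability measure on 𝓔^N, and let f be a Borel probability measure on 𝓔. Then for every integer k with 1 ≤ k ≤ N, one has the two inequalities (1/2)·‖f^{k,N} − f^{⊗k}‖_TV² ≤ H(f^{k,N} | f^{⊗k}) ≤ (k/N)·H(f^N | f^{⊗N}), where f^{k,N} denotes the k-th marginal of f^N. (The left inequality is Pinsker's inequality; the right inequality is Csiszár's subadditivity inequality for exchangeable measures. Both sides are understood in [0, +∞].) -/

import Mathlib

open MeasureTheory
open scoped ENNReal Classical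

/-- Relative entropy (Kullback–Leibler divergence) `H(ν|μ) ∈ [0,∞]`, written for probability
measures via the nonnegative integrand `t log t − t + 1` applied to the Radon–Nikodym
derivative; it equals `∫ log(dν/dμ) dν` when `ν ≪ μ` and `+∞` otherwise. -/
noncomputable def relEntropy {α : Type*} [MeasurableSpace α] (ν μ : Measure α) : ℝ≥0∞ :=
  if ν ≪ μ then
    ∫⁻ x, ENNReal.ofReal
      ((ν.rnDeriv μ x).toReal * Real.log (ν.rnDeriv μ x).toReal
        - (ν.rnDeriv μ x).toReal + 1) ∂μ
  else ⊤

/-- Total variation norm `‖μ − ν‖_TV = 2 sup_A |μ(A) − ν(A)|`, normalized so that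
`‖μ − ν‖_TV ≤ 2` for probability measures. -/
noncomputable def tvNorm {α : Type*} [MeasurableSpace α] (μ ν : Measure α) : ℝ :=
  2 * ⨆ A : {s : Set α // MeasurableSet s}, |(μ A.1).toReal - (ν A.1).toReal|

open InformationTheory ProbabilityTheory

theorem relEntropy_eq_klDiv {α : Type*} [MeasurableSpace α] (ν μ : Measure α)
    [IsFiniteMeasure ν] [IsFiniteMeasure μ] : relEntropy ν μ = klDiv ν μ := by
  rw [relEntropy, klDiv_eq_lintegral_klFun]
  simp only [klFun_apply, sub_add_eq_add_sub]

theorem three_mul_sq_sub_one_le_mul_klFun {t : ℝ} (ht : 0 ≤ t) :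
    3 * (t - 1) ^ 2 ≤ (2 * t + 4) * klFun t := by
  let g : ℝ → ℝ := fun t => (2 * t + 4) * klFun t - 3 * (t - 1) ^ 2
  let g' : ℝ → ℝ := fun t => (4 * t + 4) * Real.log t - 8 * (t - 1)
  have hg : ∀ x : ℝ, 0 < x → HasDerivAt g (g' x) x := fun x hx => by
    have h := ((((hasDerivAt_id x).const_mul 2).add_const 4).mul
      (hasDerivAt_klFun hx.ne')).sub ((((hasDerivAt_id x).sub_const 1).pow 2).const_mul 3)
    convert! h using 1
    simp only [g', klFun_apply, id]
    ring
  have hg' : ∀ x : ℝ, 0 < x → HasDerivAt g' (4 * (Real.log x + x⁻¹ - 1)) x := fun x hx => by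
    have h := ((((hasDerivAt_id x).const_mul 4).add_const 4).mul
      (Real.hasDerivAt_log hx.ne')).sub (((hasDerivAt_id x).sub_const 1).const_mul 8)
    convert! h using 1
    simp only [id]
    field_simp
    ring
  have hcont : Continuous g := by
    have := continuous_klFun
    fun_prop
  have hmono : MonotoneOn g' (Set.Ioi 0) := by
    refine monotoneOn_of_deriv_nonneg (convex_Ioi 0)
      (fun x hx => (hg' x hx).continuousAt.continuousWithinAt)
      (fun x hx => (hg' x (interior_subset hx)).differentiableAt.differentiableWithinAt)
      fun x hx => ?_
    have hx : 0 < x := interior_subset hx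
    rw [(hg' x hx).deriv]
    linarith [Real.one_sub_inv_le_log_of_pos hx]
  have hg'1 : g' 1 = 0 := by simp [g']
  have hg1 : g 1 = 0 := by simp [g, klFun_one]
  suffices 0 ≤ g t by simpa [g] using this
  rw [← hg1]
  rcases le_total t 1 with h | h
  · refine antitoneOn_of_deriv_nonpos (convex_Icc 0 1) hcont.continuousOn (fun x hx => ?_)
      (fun x hx => ?_) ⟨ht, h⟩ ⟨zero_le_one, le_rfl⟩ h
    all_goals rw [interior_Icc] at hx
    · exact (hg x hx.1).differentiableAt.differentiableWithinAt
    · rw [(hg x hx.1).deriv, ← hg'1]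
      exact hmono hx.1 (Set.mem_Ioi.2 one_pos) hx.2.le
  · refine monotoneOn_of_deriv_nonneg (convex_Ici 1) hcont.continuousOn (fun x hx => ?_)
      (fun x hx => ?_) Set.self_mem_Ici h h
    all_goals
      rw [interior_Ici] at hx
      have hx0 : 0 < x := one_pos.trans hx
    · exact (hg x hx0).differentiableAt.differentiableWithinAt
    · rw [(hg x hx0).deriv, ← hg'1]
      exact hmono (Set.mem_Ioi.2 one_pos) hx0 (le_of_lt hx)

theorem two_mul_sq_measure_sub_le_toReal_klDiv {α : Type*} [MeasurableSpace α]
    (μ ν : Measure α) [IsProbabilityMeasure μ] [IsProbabilityMeasure ν] (h : klDiv μ ν ≠ ⊤)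
    {A : Set α} (hA : MeasurableSet A) :
    2 * (μ.real A - ν.real A) ^ 2 ≤ (klDiv μ ν).toReal := by
  obtain ⟨hac, hint⟩ := klDiv_ne_top_iff.1 h
  rw [toReal_klDiv_eq_integral_klFun hac]
  have hkl := (integrable_klFun_rnDeriv_iff hac).2 hint
  set r : α → ℝ := fun x => (μ.rnDeriv ν x).toReal
  have hr : Integrable r ν := Measure.integrable_toReal_rnDeriv
  have hr1 : ∫ x, r x ∂ν = 1 := by
    simpa using Measure.integral_toReal_rnDeriv hac
  have hrA : ∫ x in A, r x ∂ν = μ.real A := Measure.setIntegral_toReal_rnDeriv hac A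
  set c := μ.real A - ν.real A with hc
  have hr' : Integrable (fun x => r x - 1) ν := hr.sub (integrable_const 1)
  have hlhs : Integrable (fun x => 2 * c * (2 * A.indicator (fun x => r x - 1) x - (r x - 1))) ν :=
    (((hr'.indicator hA).const_mul 2).sub hr').const_mul _
  have hw : Integrable (fun x => c ^ 2 * (2 * r x + 4) / 3) ν :=
    (((hr.const_mul 2).add (integrable_const 4)).const_mul _).div_const _
  have key : ∫ x, 2 * c * (2 * A.indicator (fun x => r x - 1) x - (r x - 1)) ∂ν
      ≤ ∫ x, (c ^ 2 * (2 * r x + 4) / 3 + klFun (r x)) ∂ν := by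
    refine integral_mono hlhs (hw.add hkl) fun x => ?_
    have h0 : 0 ≤ r x := ENNReal.toReal_nonneg
    have h3 := three_mul_sq_sub_one_le_mul_klFun h0
    have hpos : 0 < 2 * r x + 4 := by linarith
    have hle : 3 * (r x - 1) ^ 2 / (2 * r x + 4) ≤ klFun (r x) := by
      rw [div_le_iff₀ hpos]; linarith
    refine le_trans ?_ (add_le_add_right hle _)
    have hsq : ∀ y : ℝ, y ^ 2 = (r x - 1) ^ 2 → 2 * c * y
        ≤ c ^ 2 * (2 * r x + 4) / 3 + 3 * (r x - 1) ^ 2 / (2 * r x + 4) := fun y hy => by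
      rw [← hy, ← sub_nonneg]
      have : c ^ 2 * (2 * r x + 4) / 3 + 3 * y ^ 2 / (2 * r x + 4) - 2 * c * y
          = (c * (2 * r x + 4) - 3 * y) ^ 2 / (3 * (2 * r x + 4)) := by
        field_simp
        ring
      rw [this]
      positivity
    apply hsq
    by_cases hx : x ∈ A
    · simp only [Set.indicator_of_mem hx]; ring
    · simp only [Set.indicator_of_notMem hx]; ring
  rw [integral_const_mul, integral_sub ((hr'.indicator hA).const_mul 2) hr', integral_const_mul,
    integral_indicator hA, integral_sub hr.integrableOn (integrable_const 1).integrableOn,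
    integral_sub hr (integrable_const 1), integral_add hw hkl, integral_div, integral_const_mul,
    integral_add (hr.const_mul 2) (integrable_const 4), integral_const_mul, hr1, hrA] at key
  simp only [integral_const, smul_eq_mul, mul_one, measureReal_restrict_apply_univ,
    probReal_univ, ← hc] at key
  linarith

theorem pinsker_tvNorm {α : Type*} [MeasurableSpace α]
    (μ ν : Measure α) [IsProbabilityMeasure μ] [IsProbabilityMeasure ν] :
    ENNReal.ofReal ((1 / 2) * tvNorm μ ν ^ 2) ≤ klDiv μ ν := by
  by_cases h : klDiv μ ν = ⊤
  · simp [h]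
  refine ENNReal.ofReal_le_of_le_toReal ?_
  set D := (klDiv μ ν).toReal
  have hD : 0 ≤ D := ENNReal.toReal_nonneg
  have : Nonempty {s : Set α // MeasurableSet s} := ⟨⟨∅, .empty⟩⟩
  have hsup : (⨆ A : {s : Set α // MeasurableSet s}, |(μ A.1).toReal - (ν A.1).toReal|)
      ≤ √(D / 2) := ciSup_le fun A => by
    refine Real.abs_le_sqrt ?_
    have := two_mul_sq_measure_sub_le_toReal_klDiv μ ν h A.2
    simp only [Measure.real] at this
    linarith
  have h0 : 0 ≤ ⨆ A : {s : Set α // MeasurableSet s}, |(μ A.1).toReal - (ν A.1).toReal| :=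
    Real.iSup_nonneg fun _ => abs_nonneg _
  have hsq := pow_le_pow_left₀ h0 hsup 2
  rw [Real.sq_sqrt (by positivity)] at hsq
  rw [tvNorm]
  linarith

theorem klDiv_map_measurableEquiv {α β : Type*} [MeasurableSpace α] [MeasurableSpace β]
    (μ ν : Measure α) [IsFiniteMeasure μ] [IsFiniteMeasure ν] (e : α ≃ᵐ β) :
    klDiv (μ.map e) (ν.map e) = klDiv μ ν := by
  refine le_antisymm (klDiv_map_le μ ν e.measurable) ?_
  have h := klDiv_map_le (μ.map e) (ν.map e) e.symm.measurable
  rwa [e.map_symm_map, e.map_symm_map] at h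

theorem klDiv_prod_eq_add {α β : Type*} [MeasurableSpace α] [MeasurableSpace β]
    [StandardBorelSpace β] [Nonempty β] (ρ : Measure (α × β)) (μ : Measure α) (ν : Measure β)
    [IsFiniteMeasure ρ] [IsFiniteMeasure μ] [IsProbabilityMeasure ν] :
    klDiv ρ (μ.prod ν) = klDiv ρ.fst μ + klDiv ρ (ρ.fst.prod ν) := by
  have h := klDiv_compProd_eq_add ρ.fst μ ρ.condKernel (Kernel.const α ν)
  rwa [ρ.disintegrate, Measure.compProd_const, Measure.compProd_const] at h

section Csiszar

variable {E : Type*} [MeasurableSpace E] {N : ℕ} [NeZero N]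

/-- The joint law of the first `k` coordinates, with indices read modulo `N`. -/
noncomputable def initialLaw (P : Measure (Fin N → E)) (k : ℕ) : Measure (Fin k → E) :=
  P.map fun x i => x (Fin.ofNat N i)

/-- The joint law of the first `k` coordinates paired with the next one. -/
noncomputable def initialNextLaw (P : Measure (Fin N → E)) (k : ℕ) :
    Measure ((Fin k → E) × E) :=
  P.map fun x => (fun i => x (Fin.ofNat N i), x (Fin.ofNat N k))

theorem fst_initialNextLaw (P : Measure (Fin N → E)) (k : ℕ) :
    (initialNextLaw P k).fst = initialLaw P k := by
  rw [Measure.fst, initialNextLaw, Measure.map_map measurable_fst (by fun_prop)]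
  rfl

variable (P : Measure (Fin N → E)) [IsProbabilityMeasure P] (f : Measure E)
  [IsProbabilityMeasure f]

instance (k : ℕ) : IsProbabilityMeasure (initialLaw P k) :=
  Measure.isProbabilityMeasure_map
    (measurable_pi_iff.2 fun _ => measurable_pi_apply _).aemeasurable

instance (k : ℕ) : IsProbabilityMeasure (initialNextLaw P k) :=
  Measure.isProbabilityMeasure_map (by fun_prop)

theorem klDiv_initialLaw_succ [StandardBorelSpace E] [Nonempty E] (k : ℕ) :
    klDiv (initialLaw P (k + 1)) (Measure.pi fun _ => f)
      = klDiv (initialLaw P k) (Measure.pi fun _ => f)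
        + klDiv (initialNextLaw P k) ((initialLaw P k).prod f) := by
  let e := (MeasurableEquiv.piFinSuccAbove (fun _ : Fin (k + 1) => E) (Fin.last k)).trans
    MeasurableEquiv.prodComm
  have he : ⇑e = fun y => (fun i : Fin k => y i.castSucc, y (Fin.last k)) := by
    funext y
    refine Prod.ext (funext fun i => ?_) rfl
    exact congrArg y (Fin.succAbove_last_apply i)
  have h1 : (initialLaw P (k + 1)).map e = initialNextLaw P k := by
    rw [he, initialLaw, initialNextLaw, Measure.map_map (by fun_prop) (by fun_prop)]
    rfl
  have h2 : (Measure.pi fun _ : Fin (k + 1) => f).map e = (Measure.pi fun _ : Fin k => f).prod f :=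
    (Measure.measurePreserving_swap.comp
      (measurePreserving_piFinSuccAbove (fun _ : Fin (k + 1) => f) (Fin.last k))).map_eq
  rw [← klDiv_map_measurableEquiv _ _ e, h1, h2, klDiv_prod_eq_add, fst_initialNextLaw]

variable {P}

theorem klDiv_initialNextLaw_le_succ
    (hP : ∀ σ : Equiv.Perm (Fin N), P.map (fun x => x ∘ σ) = P) {k : ℕ} (hk : k + 1 < N) :
    klDiv (initialNextLaw P k) ((initialLaw P k).prod f)
      ≤ klDiv (initialNextLaw P (k + 1)) ((initialLaw P (k + 1)).prod f) := by
  have hg : Measurable fun y : Fin (k + 1) → E => fun i : Fin k => y i.castSucc := by fun_prop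
  have h1 : (initialLaw P (k + 1)).map (fun y (i : Fin k) => y i.castSucc) = initialLaw P k := by
    rw [initialLaw, initialLaw, Measure.map_map hg (by fun_prop)]
    rfl
  have h2 : (initialNextLaw P (k + 1)).map (Prod.map (fun y (i : Fin k) => y i.castSucc) id)
      = initialNextLaw P k := by
    rw [initialNextLaw, initialNextLaw, Measure.map_map (hg.prodMap measurable_id) (by fun_prop)]
    conv_rhs => rw [← hP (Equiv.swap (Fin.ofNat N k) (Fin.ofNat N (k + 1)))]
    rw [Measure.map_map (by fun_prop) (by fun_prop)]
    congr 1
    ext x i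
    · have hi := i.2
      have hne : ∀ j < N, (i : ℕ) ≠ j → Fin.ofNat N i ≠ Fin.ofNat N j := fun j hj hij h => by
        have := congrArg Fin.val h
        simp only [Fin.val_ofNat] at this
        rw [Nat.mod_eq_of_lt (by omega), Nat.mod_eq_of_lt hj] at this
        exact hij this
      exact congrArg x (Equiv.swap_apply_of_ne_of_ne (hne k (by omega) (by omega))
        (hne (k + 1) hk (by omega))).symm
    · simp
  have h := klDiv_map_le (initialNextLaw P (k + 1)) ((initialLaw P (k + 1)).prod f)
    (hg.prodMap measurable_id)
  rwa [h2, ← Measure.map_prod_map _ _ hg measurable_id, h1, Measure.map_id] at h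

/-- **Csiszár's subadditivity inequality** for exchangeable measures. -/
theorem natCast_mul_klDiv_initialLaw_le [StandardBorelSpace E] [Nonempty E]
    (hP : ∀ σ : Equiv.Perm (Fin N), P.map (fun x => x ∘ σ) = P) {k : ℕ} (hk : k ≤ N) :
    N * klDiv (initialLaw P k) (Measure.pi fun _ => f)
      ≤ k * klDiv (initialLaw P N) (Measure.pi fun _ => f) := by
  let d : ℕ → ℝ≥0∞ := fun j => klDiv (initialNextLaw P j) ((initialLaw P j).prod f)
  have hsum : ∀ n, klDiv (initialLaw P n) (Measure.pi fun _ => f)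
      = ∑ j ∈ Finset.range n, d j := fun n => by
    induction n with
    | zero =>
      have : initialLaw P 0 = Measure.pi fun _ => f :=
        Measure.ext fun s _ => by
          rcases s.eq_empty_or_nonempty with rfl | hs
          · simp
          · rw [Subsingleton.eq_univ_of_nonempty hs, measure_univ, measure_univ]
      rw [this, klDiv_self, Finset.sum_range_zero]
    | succ n ih => rw [klDiv_initialLaw_succ, ih, Finset.sum_range_succ]
  have hmono : ∀ i j, i ≤ j → j < N → d i ≤ d j := fun i j hij => by
    induction j, hij using Nat.le_induction with
    | base => exact fun _ => le_rfl
    | succ j _ ih =>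
      exact fun hj => (ih (by omega)).trans (klDiv_initialNextLaw_le_succ f hP hj)
  have hstep : ∀ n, k ≤ n → n ≤ N →
      n * ∑ j ∈ Finset.range k, d j ≤ k * ∑ j ∈ Finset.range n, d j := fun n hkn => by
    induction n, hkn using Nat.le_induction with
    | base => exact fun _ => le_rfl
    | succ n hkn ih =>
      intro hn
      have hle : ∑ j ∈ Finset.range k, d j ≤ k * d n := by
        have := Finset.sum_le_card_nsmul (Finset.range k) d (d n)
          fun i hi => hmono i n ((Finset.mem_range.1 hi).le.trans hkn) hn
        simpa using this
      rw [Finset.sum_range_succ, mul_add, Nat.cast_succ, add_mul, one_mul]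
      exact add_le_add (ih (by omega)) hle
  rw [hsum, hsum]
  exact hstep N hk le_rfl

end Csiszar

/-- **Pinsker and Csiszár inequalities for exchangeable measures**: for a symmetric probability
measure `f^N` on `𝓔^N` and `1 ≤ k ≤ N`,
`(1/2)‖f^{k,N} − f^{⊗k}‖_TV² ≤ H(f^{k,N}|f^{⊗k}) ≤ (k/N) H(f^N|f^{⊗N})`. -/
theorem pinsker_csiszar_exchangeable
    {𝓔 : Type*} [MeasurableSpace 𝓔] [TopologicalSpace 𝓔] [PolishSpace 𝓔] [BorelSpace 𝓔]
    {N : ℕ} (hN : 1 ≤ N)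
    (fN : Measure (Fin N → 𝓔)) [IsProbabilityMeasure fN]
    (hsym : ∀ σ : Equiv.Perm (Fin N), fN.map (fun x => x ∘ σ) = fN)
    (f : Measure 𝓔) [IsProbabilityMeasure f]
    (k : ℕ) (hk1 : 1 ≤ k) (hkN : k ≤ N) :
    ENNReal.ofReal ((1 / 2) *
        tvNorm (fN.map fun x (i : Fin k) => x (Fin.castLE hkN i))
          (Measure.pi fun _ : Fin k => f) ^ 2)
      ≤ relEntropy (fN.map fun x (i : Fin k) => x (Fin.castLE hkN i))
          (Measure.pi fun _ : Fin k => f)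
    ∧ relEntropy (fN.map fun x (i : Fin k) => x (Fin.castLE hkN i))
          (Measure.pi fun _ : Fin k => f)
        ≤ ((k : ℝ≥0∞) / (N : ℝ≥0∞)) * relEntropy fN (Measure.pi fun _ : Fin N => f) := by
  have : NeZero N := ⟨by omega⟩
  have : Nonempty 𝓔 := nonempty_of_isProbabilityMeasure f
  have hmarg : ∀ m (h : m ≤ N),
      fN.map (fun x (i : Fin m) => x (Fin.castLE h i)) = initialLaw fN m := fun m h => by
    rw [initialLaw]
    congr! with x i
    exact Fin.ext (by simp [Nat.mod_eq_of_lt (i.2.trans_le h)])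
  rw [hmarg k hkN, relEntropy_eq_klDiv, relEntropy_eq_klDiv]
  refine ⟨pinsker_tvNorm _ _, ?_⟩
  have hfN : initialLaw fN N = fN := by
    rw [← hmarg N le_rfl]
    exact Measure.map_id
  have h := natCast_mul_klDiv_initialLaw_le f hsym hkN
  rw [hfN] at h
  rw [mul_comm, ← mul_div_assoc, mul_comm,
    ENNReal.le_div_iff_mul_le (.inl (by simp; omega)) (.inl (by simp)), mul_comm]
  exact h
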